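/- Consider the model f((w,a), x) = a e^{xᵀw} with (w, a) ∈ R^{M-1} × R and loss L(θ) = |a e^{xᵀw} − y|². For any sample (x, y) and any initial point (w₀, a₀), the gradient flow trajectory starting at (w₀, a₀) converges as t → ∞. -/

import Mathlib

/-- For the model `f((w,a), x) = a e^{xᵀw}` with loss `|a e^{xᵀw} - y|²`, for any sample
`(x, y)` and any initial point `(w₀, a₀)`, the gradient flow trajectory converges as `t → ∞`. -/
theorem exp_model_gradient_flow_converges {n : ℕ} (x : Fin n → ℝ) (y : ℝ)
    (w : ℝ → Fin n → ℝ) (a : ℝ → ℝ) (w₀ : Fin n → ℝ) (a₀ : ℝ)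
    (hw0 : w 0 = w₀) (ha0 : a 0 = a₀)
    (hda : ∀ t ≥ (0:ℝ), HasDerivAt a
      (-2 * (a t * Real.exp (∑ i, x i * w t i) - y) * Real.exp (∑ i, x i * w t i)) t)
    (hdw : ∀ t ≥ (0:ℝ), HasDerivAt w
      ((-2 * (a t * Real.exp (∑ i, x i * w t i) - y) * a t * Real.exp (∑ i, x i * w t i)) • x) t) :
    ∃ (wlim : Fin n → ℝ) (alim : ℝ),
      Filter.Tendsto (fun t => (w t, a t)) Filter.atTop (nhds (wlim, alim)) := by
  -- conservation law
  have hcons : ∀ t ≥ (0:ℝ), w t = w 0 + (((a t)^2 - (a 0)^2)/2) • x := by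
    intro t ht
    have hd : ∀ s ≥ (0:ℝ), HasDerivAt (fun s => w s - ((a s)^2/2) • x) 0 s := by
      intro s hs
      have h1 := (((hda s hs).pow 2).div_const 2).smul_const x
      have h2 := (hdw s hs).sub h1
      refine h2.congr_deriv ?_
      rw [← sub_smul]
      have : ∀ z : ℝ, z = 0 → z • x = 0 := by
        intro z hz; rw [hz, zero_smul]
      apply this
      push_cast
      ring
    have h := constant_of_has_deriv_right_zero (f := fun s => w s - ((a s)^2/2) • x)
      (a := 0) (b := t)
      (fun s hs => (hd s hs.1).continuousAt.continuousWithinAt)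
      (fun s hs => (hd s hs.1).hasDerivWithinAt) t ⟨ht, le_rfl⟩
    rw [sub_eq_iff_eq_add] at h
    rw [h, sub_div, sub_smul]
    abel
  set c : ℝ := ∑ i, x i * x i with hc
  have hc0 : 0 ≤ c := Finset.sum_nonneg fun i _ => mul_self_nonneg _
  set s0 : ℝ := ∑ i, x i * w 0 i with hs0
  set E : ℝ → ℝ := fun b => Real.exp (s0 + c * ((b^2 - (a 0)^2)/2)) with hE
  have hsum : ∀ t ≥ (0:ℝ), Real.exp (∑ i, x i * w t i) = E (a t) := by
    intro t ht
    simp only [hE]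
    congr 1
    rw [hcons t ht, hs0, hc, Finset.sum_mul, ← Finset.sum_add_distrib]
    refine Finset.sum_congr rfl fun i _ => ?_
    simp only [Pi.add_apply, Pi.smul_apply, smul_eq_mul]
    ring
  set m : ℝ := E 0 with hm
  have hm0 : 0 < m := Real.exp_pos _
  have hmono : ∀ p q : ℝ, p^2 ≤ q^2 → E p ≤ E q := by
    intro p q hpq
    apply Real.exp_le_exp.2
    have := mul_le_mul_of_nonneg_left hpq hc0
    linarith
  have hmE : ∀ p, m ≤ E p := fun p => hmono 0 p (by nlinarith [sq_nonneg p])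
  have hEc : Continuous E := by simp only [hE]; fun_prop
  -- the root
  obtain ⟨r, hr⟩ : ∃ r, r * E r = y := by
    have hK : 0 ≤ |y| / m := by positivity
    have h1 : |y| ≤ |y| / m * E (|y| / m) := by
      calc |y| = |y| / m * m := by field_simp
        _ ≤ _ := mul_le_mul_of_nonneg_left (hmE _) hK
    have h2 : |y| ≤ |y| / m * E (-(|y| / m)) := by
      calc |y| = |y| / m * m := by field_simp
        _ ≤ _ := mul_le_mul_of_nonneg_left (hmE _) hK
    have := mem_range_of_exists_le_of_exists_ge (f := fun r => r * E r) (c := y)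
      (by fun_prop) ⟨-(|y| / m), by linarith [neg_abs_le y]⟩
      ⟨|y| / m, by linarith [le_abs_self y]⟩
    exact this
  have hstrong : ∀ p q : ℝ, m * (p - q)^2 ≤ (p - q) * (p * E p - q * E q) := by
    intro p q
    have h1 : 0 ≤ (E p - E q) * (p^2 - q^2) := by
      rcases le_total (p^2) (q^2) with h | h
      · exact mul_nonneg_of_nonpos_of_nonpos (by linarith [hmono p q h]) (by linarith)
      · exact mul_nonneg (by linarith [hmono q p h]) (by linarith)
    have h2 : 0 ≤ ((E p - m) + (E q - m)) * (p - q)^2 :=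
      mul_nonneg (by linarith [hmE p, hmE q]) (sq_nonneg _)
    nlinarith
  set V : ℝ → ℝ := fun t => Real.exp (4 * m^2 * t) * (a t - r)^2 with hV
  have hVd : ∀ t ≥ (0:ℝ), HasDerivAt V
      (Real.exp (4 * m^2 * t) * (4 * m^2 * (a t - r)^2
        - 4 * ((a t - r) * (a t * E (a t) - r * E r)) * E (a t))) t := by
    intro t ht
    have h1 : HasDerivAt (fun t => Real.exp (4 * m^2 * t))
        (Real.exp (4 * m^2 * t) * (4 * m^2 * 1)) t :=
      ((hasDerivAt_id t).const_mul (4 * m^2)).exp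
    have h2 := h1.mul (((hda t ht).sub_const r).pow 2)
    refine h2.congr_deriv ?_
    rw [hsum t ht, hr]
    simp only [Pi.pow_apply]
    push_cast
    ring
  have hanti : AntitoneOn V (Set.Ici 0) := by
    apply antitoneOn_of_deriv_nonpos (convex_Ici 0)
    · exact fun t ht => (hVd t ht).continuousAt.continuousWithinAt
    · intro t ht
      exact (hVd t (interior_subset ht)).differentiableAt.differentiableWithinAt
    · intro t ht
      rw [(hVd t (interior_subset ht)).deriv]
      apply mul_nonpos_of_nonneg_of_nonpos (Real.exp_pos _).le
      have h1 := hstrong (a t) r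
      have h2 := hmE (a t)
      have h3 : m * (a t - r)^2 * m ≤ (a t - r) * (a t * E (a t) - r * E r) * E (a t) :=
        mul_le_mul h1 h2 hm0.le (le_trans (by positivity) h1)
      nlinarith
  have hbound : ∀ t ≥ (0:ℝ), (a t - r)^2 ≤ V 0 * Real.exp (-(4 * m^2 * t)) := by
    intro t ht
    have h := hanti (Set.mem_Ici.2 le_rfl) (Set.mem_Ici.2 ht) ht
    rw [Real.exp_neg, ← div_eq_mul_inv, le_div_iff₀ (Real.exp_pos _), mul_comm]
    exact h
  have hexp : Filter.Tendsto (fun t : ℝ => V 0 * Real.exp (-(4 * m^2 * t)))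
      Filter.atTop (nhds 0) := by
    have h1 : Filter.Tendsto (fun t : ℝ => 4 * m^2 * t) Filter.atTop Filter.atTop :=
      Filter.Tendsto.const_mul_atTop (by positivity) Filter.tendsto_id
    have h2 := (Real.tendsto_exp_neg_atTop_nhds_zero.comp h1).const_mul (V 0)
    simpa using h2
  have hsq : Filter.Tendsto (fun t => (a t - r)^2) Filter.atTop (nhds 0) := by
    refine tendsto_of_tendsto_of_tendsto_of_le_of_le' tendsto_const_nhds hexp
      (Filter.Eventually.of_forall fun t => sq_nonneg _) ?_
    filter_upwards [Filter.eventually_ge_atTop 0] with t ht using hbound t ht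
  have ha : Filter.Tendsto a Filter.atTop (nhds r) := by
    have h1 := hsq.sqrt
    simp only [Real.sqrt_sq_eq_abs, Real.sqrt_zero] at h1
    have h2 := (tendsto_zero_iff_abs_tendsto_zero (fun t => a t - r)).2 h1
    simpa using h2.add_const r
  refine ⟨w 0 + ((r^2 - (a 0)^2)/2) • x, r, ?_⟩
  refine Filter.Tendsto.prodMk_nhds ?_ ha
  have hw : Filter.Tendsto (fun t => w 0 + (((a t)^2 - (a 0)^2)/2) • x) Filter.atTop
      (nhds (w 0 + ((r^2 - (a 0)^2)/2) • x)) :=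
    ((((ha.pow 2).sub_const _).div_const 2).smul_const x).const_add _
  refine hw.congr' ?_
  filter_upwards [Filter.eventually_ge_atTop 0] with t ht using (hcons t ht).symm
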